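/- Let n ≥ 1 and let s_λ = s_λ(x_1,...,x_n) denote the Schur polynomial in n variables. For all integers r, s ≥ 1, the rectangular Schur polynomials satisfy the Q-system relation s_{(s^r)}^2 = s_{((s+1)^r)} · s_{((s-1)^r)} + s_{(s^{r+1})} · s_{(s^{r-1})}, where (s^r) denotes the rectangular partition with r parts equal to s, s_{(s^0)} = 1, and s_λ = 0 if λ has more than n parts. -/

import Mathlib

open MvPolynomial

/-- The complete homogeneous symmetric polynomial `h_k` in `n` variables over `ℚ`. -/
noncomputable def completeHomog (n k : ℕ) : MvPolynomial (Fin n) ℚ :=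
  ∑ d ∈ Finset.Nat.antidiagonalTuple n k, ∏ i, X i ^ d i

/-- `h_k` extended to integer indices: `h_k = 0` for `k < 0`. -/
noncomputable def completeHomogZ (n : ℕ) (k : ℤ) : MvPolynomial (Fin n) ℚ :=
  if 0 ≤ k then completeHomog n k.toNat else 0

/-- The Schur polynomial of the rectangular partition `(s^r)` in `n` variables,
via the Jacobi–Trudi determinant `det (h_{s - i + j})_{1 ≤ i,j ≤ r}`, with the
convention that `s_λ = 0` if `λ` has more than `n` parts. -/
noncomputable def schurRect (n s r : ℕ) : MvPolynomial (Fin n) ℚ :=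
  if r ≤ n then
    Matrix.det (Matrix.of fun i j : Fin r =>
      completeHomogZ n ((s : ℤ) - (i : ℤ) + (j : ℤ)))
  else 0

section Helpers

open Matrix

theorem aux_two_col {m R : Type*} [Fintype m] [DecidableEq m] [CommRing R]
    (A : Matrix m m R) (i j : m) (hij : i ≠ j) (u v : m → R) :
    A.det * ((A.updateCol i u).updateCol j v).det
      = (A.updateCol i u).det * (A.updateCol j v).det
        - (A.updateCol i v).det * (A.updateCol j u).det := by
  have hv : A.det • v = ∑ k, cramer A v k • (fun l => A l k) := by
    rw [← mulVec_cramer]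
    ext l
    simp [mulVec, dotProduct, mul_comm]
  rw [← det_updateCol_smul, hv]
  change cramer (A.updateCol i u) _ j = _
  rw [map_sum, Finset.sum_apply]
  rw [Finset.sum_eq_add i j hij]
  · simp only [cramer_apply]
    have h1 : (A.updateCol i u).updateCol j (fun l => A l j) = A.updateCol i u := by
      ext a b
      by_cases hb : b = j
      · subst hb; simp [updateCol_apply, hij.symm]
      · simp [updateCol_apply, hb]
    have h2 : (A.updateCol i u).updateCol j (fun l => A l i)
        = (A.updateCol j u).submatrix id (Equiv.swap i j) := by
      ext a b
      by_cases hb : b = j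
      · subst hb; simp [updateCol_apply, hij]
      · by_cases hb' : b = i
        · subst hb'; simp [updateCol_apply, hij]
        · simp [updateCol_apply, hb, hb', Equiv.swap_apply_of_ne_of_ne hb' hb]
    rw [det_updateCol_smul, det_updateCol_smul, h1, h2, det_permute', Equiv.Perm.sign_swap hij]
    simp
    ring
  · intro k _ hk
    simp only [cramer_apply]
    rw [det_updateCol_smul, det_zero_of_column_eq (M := (A.updateCol i u).updateCol j fun l => A l k)
      (i := k) (j := j) hk.2, mul_zero]
    intro l
    simp [updateCol_apply, hk.1, hk.2]
  · simp
  · simp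

theorem aux_updateCol_single {R : Type*} [CommRing R] {N : ℕ}
    (A : Matrix (Fin (N + 1)) (Fin (N + 1)) R) (i j : Fin (N + 1)) :
    (A.updateCol i (Pi.single j 1)).det
      = (-1) ^ (j + i : ℕ) * (A.submatrix j.succAbove i.succAbove).det := by
  rw [← cramer_apply, cramer_eq_adjugate_mulVec, mulVec_single_one, col_apply,
    adjugate_fin_succ_eq_det_submatrix]

theorem aux_desnanot {R : Type*} [CommRing R] {N : ℕ}
    (A : Matrix (Fin (N + 2)) (Fin (N + 2)) R) :
    A.det * (A.submatrix (fun i : Fin N => i.succ.castSucc) (fun i : Fin N => i.succ.castSucc)).det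
      = (A.submatrix Fin.succ Fin.succ).det * (A.submatrix Fin.castSucc Fin.castSucc).det
        - (A.submatrix Fin.castSucc Fin.succ).det * (A.submatrix Fin.succ Fin.castSucc).det := by
  have h := aux_two_col A 0 (Fin.last (N + 1)) (Fin.last_pos.ne)
    (Pi.single 0 1) (Pi.single (Fin.last (N + 1)) 1)
  have e : ((A.updateCol 0 (Pi.single 0 1)).submatrix Fin.castSucc Fin.castSucc)
      = (A.submatrix Fin.castSucc Fin.castSucc).updateCol 0 (Pi.single (0 : Fin (N + 1)) 1) := by
    ext a b
    simp [updateCol_apply, Pi.single_apply]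
  have sgn : ((-1 : R) ^ (N + 1)) * (-1) ^ (N + 1) = 1 := by
    rw [← mul_pow]; simp
  have e2 : ((-1 : R) ^ (N + 1 + (N + 1))) = 1 := by rw [pow_add, sgn]
  simp only [aux_updateCol_single, Fin.succAbove_last, Fin.succAbove_zero, e, Fin.val_zero,
    Fin.val_last, submatrix_submatrix, zero_add, add_zero, pow_zero, one_mul, e2] at h
  refine h.trans ?_
  linear_combination (-((A.submatrix Fin.castSucc Fin.succ).det * (A.submatrix Fin.succ Fin.castSucc).det)) * sgn

theorem aux_gen (n : ℕ) :
    (PowerSeries.mk (completeHomog n))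
      = ∏ i : Fin n, PowerSeries.mk (fun k => (X i : MvPolynomial (Fin n) ℚ) ^ k) := by
  ext1 d
  rw [PowerSeries.coeff_prod, PowerSeries.coeff_mk, completeHomog]
  symm
  refine Finset.sum_equiv Finsupp.equivFunOnFinite ?_ ?_
  · intro l
    simp [Finset.Nat.mem_antidiagonalTuple, Finset.mem_finsuppAntidiag]
  · intro l _
    simp

theorem aux_geom {R : Type*} [CommRing R] (x : R) :
    PowerSeries.mk (fun k => x ^ k) * (1 - PowerSeries.C x * PowerSeries.X) = 1 := by
  ext d
  rw [mul_sub, mul_one, map_sub, ← mul_assoc]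
  cases d with
  | zero => simp
  | succ d =>
    rw [PowerSeries.coeff_succ_mul_X, PowerSeries.coeff_mul_C]
    simp [PowerSeries.coeff_one, pow_succ]

theorem aux_rec (n : ℕ) : ∃ c : Fin (n + 1) → MvPolynomial (Fin n) ℚ, c 0 = 1 ∧
    ∀ m : ℕ, 1 ≤ m → ∑ i, c i * completeHomogZ n ((m : ℤ) - (i : ℕ)) = 0 := by
  let P : Polynomial (MvPolynomial (Fin n) ℚ) :=
    ∏ i : Fin n, (1 - Polynomial.C (X i) * Polynomial.X)
  have hdeg : P.natDegree ≤ n := by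
    refine (Polynomial.natDegree_prod_le _ _).trans ?_
    refine (Finset.sum_le_card_nsmul _ _ 1 ?_).trans (by simp)
    intro i _
    compute_degree
  have hP0 : P.coeff 0 = 1 := by
    simp [P, Polynomial.coeff_zero_prod]
  have hmul : (P : PowerSeries (MvPolynomial (Fin n) ℚ)) * PowerSeries.mk (completeHomog n) = 1 := by
    have : (P : PowerSeries (MvPolynomial (Fin n) ℚ))
        = ∏ i : Fin n, (1 - PowerSeries.C (X i) * PowerSeries.X) := by
      rw [← Polynomial.coeToPowerSeries.ringHom_apply, map_prod]
      simp
    rw [this, aux_gen, ← Finset.prod_mul_distrib]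
    refine Finset.prod_eq_one fun i _ => ?_
    rw [mul_comm, aux_geom]
  refine ⟨fun i => P.coeff i, hP0, fun m hm => ?_⟩
  have h := congrArg (PowerSeries.coeff m) hmul
  rw [PowerSeries.coeff_mul, PowerSeries.coeff_one, if_neg (by omega),
    Finset.Nat.sum_antidiagonal_eq_sum_range_succ_mk] at h
  simp only [Polynomial.coeff_coe, PowerSeries.coeff_mk] at h
  rw [Fin.sum_univ_eq_sum_range
    (fun i => P.coeff i * completeHomogZ n ((m : ℤ) - (i : ℕ))) (n + 1), ← h]
  have hz : ∀ i, i ∉ Finset.range (n + 1) → P.coeff i * completeHomogZ n ((m : ℤ) - (i : ℕ)) = 0 := by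
    intro i hi
    rw [Polynomial.coeff_eq_zero_of_natDegree_lt, zero_mul]
    simp at hi; omega
  have hz2 : ∀ i, i ∉ Finset.range (m + 1) → P.coeff i * completeHomogZ n ((m : ℤ) - (i : ℕ)) = 0 := by
    intro i hi
    simp at hi
    rw [completeHomogZ, if_neg (by omega), mul_zero]
  have hR : ∑ i ∈ Finset.range (m + 1), P.coeff i * completeHomog n (m - i)
      = ∑ i ∈ Finset.range (m + 1), P.coeff i * completeHomogZ n ((m : ℤ) - (i : ℕ)) := by
    refine Finset.sum_congr rfl fun i hi => ?_
    simp at hi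
    rw [completeHomogZ, if_pos (by omega)]
    congr 2
    omega
  rw [Nat.succ_eq_add_one, hR]
  rw [Finset.sum_subset (Finset.range_mono (show n + 1 ≤ n + 1 + (m + 1) by omega))
      (fun i _ hi => hz i hi),
    Finset.sum_subset (Finset.range_mono (show m + 1 ≤ n + 1 + (m + 1) by omega))
      (fun i _ hi => hz2 i hi)]

theorem aux_det_zero (n s : ℕ) (hs : 1 ≤ s) :
    Matrix.det (Matrix.of fun i j : Fin (n + 1) =>
      completeHomogZ n ((s : ℤ) - (i : ℤ) + (j : ℤ))) = 0 := by
  obtain ⟨c, hc0, hc⟩ := aux_rec n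
  refine Matrix.exists_vecMul_eq_zero_iff.mp ⟨c, ?_, ?_⟩
  · intro h
    rw [h] at hc0
    simp at hc0
  · ext1 j
    rw [Pi.zero_apply, ← hc (s + j) (by omega)]
    simp only [vecMul, dotProduct, of_apply]
    refine Finset.sum_congr rfl fun i _ => ?_
    congr 2
    push_cast
    ring

theorem aux_Q (n s N : ℕ) (hs : 1 ≤ s) :
    let D : ℕ → ℕ → MvPolynomial (Fin n) ℚ := fun s r =>
      Matrix.det (Matrix.of fun i j : Fin r =>
        completeHomogZ n ((s : ℤ) - (i : ℤ) + (j : ℤ)))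
    D s (N + 1) ^ 2 = D (s + 1) (N + 1) * D (s - 1) (N + 1) + D s (N + 2) * D s N := by
  intro D
  have h := aux_desnanot (Matrix.of fun i j : Fin (N + 2) =>
        completeHomogZ n ((s : ℤ) - (i : ℤ) + (j : ℤ)))
  have e1 : (Matrix.of fun i j : Fin (N + 2) =>
        completeHomogZ n ((s : ℤ) - (i : ℤ) + (j : ℤ))).det = D s (N + 2) := rfl
  rw [e1] at h
  have e2 : ((Matrix.of fun i j : Fin (N + 2) =>
        completeHomogZ n ((s : ℤ) - (i : ℤ) + (j : ℤ))).submatrix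
          (fun i : Fin N => i.succ.castSucc) (fun i : Fin N => i.succ.castSucc)).det = D s N := by
    simp only [D]; congr 1; ext1 i j; simp only [submatrix_apply, of_apply]; congr 1
    simp; ring
  have e3 : ((Matrix.of fun i j : Fin (N + 2) =>
        completeHomogZ n ((s : ℤ) - (i : ℤ) + (j : ℤ))).submatrix
          Fin.succ Fin.succ).det = D s (N + 1) := by
    simp only [D]; congr 1; ext1 i j; simp only [submatrix_apply, of_apply]; congr 1
    simp; ring
  have e4 : ((Matrix.of fun i j : Fin (N + 2) =>
        completeHomogZ n ((s : ℤ) - (i : ℤ) + (j : ℤ))).submatrix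
          Fin.castSucc Fin.castSucc).det = D s (N + 1) := by
    simp only [D]; congr 1
  have e5 : ((Matrix.of fun i j : Fin (N + 2) =>
        completeHomogZ n ((s : ℤ) - (i : ℤ) + (j : ℤ))).submatrix
          Fin.castSucc Fin.succ).det = D (s + 1) (N + 1) := by
    simp only [D]; congr 1; ext1 i j; simp only [submatrix_apply, of_apply]; congr 1
    simp; ring
  have e6 : ((Matrix.of fun i j : Fin (N + 2) =>
        completeHomogZ n ((s : ℤ) - (i : ℤ) + (j : ℤ))).submatrix
          Fin.succ Fin.castSucc).det = D (s - 1) (N + 1) := by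
    simp only [D]; congr 1; ext1 i j; simp only [submatrix_apply, of_apply]; congr 1
    simp [Nat.cast_sub hs]; ring
  rw [e2, e3, e4, e5, e6] at h
  linear_combination -h

end Helpers

/-- The Q-system relation for rectangular Schur polynomials:
`s_{(s^r)}² = s_{((s+1)^r)}·s_{((s-1)^r)} + s_{(s^{r+1})}·s_{(s^{r-1})}`. -/
theorem schur_rect_Q_system (n : ℕ) (hn : 1 ≤ n) (r s : ℕ) (hr : 1 ≤ r) (hs : 1 ≤ s) :
    schurRect n s r ^ 2
      = schurRect n (s + 1) r * schurRect n (s - 1) r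
        + schurRect n s (r + 1) * schurRect n s (r - 1) := by
  obtain ⟨N, rfl⟩ : ∃ N, r = N + 1 := ⟨r - 1, by omega⟩
  have h := aux_Q n s N hs
  simp only at h
  simp only [schurRect, Nat.add_sub_cancel]
  by_cases h1 : N + 1 ≤ n
  · rw [if_pos h1, if_pos h1, if_pos h1, if_pos (show N ≤ n by omega), h]
    by_cases h2 : N + 1 + 1 ≤ n
    · rw [if_pos h2]
      rfl
    · rw [if_neg h2]
      obtain rfl : n = N + 1 := by omega
      rw [aux_det_zero (N + 1) s hs]
      rfl
  · rw [if_neg h1, if_neg h1, if_neg (show ¬ (N + 1 + 1 ≤ n) by omega)]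
    simp
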